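/- A holomorphic automorphism F of ℂⁿ is affine (F(z) = F(0) + DF(0)z) if and only if the function z ↦ log(‖DF(0)⁻¹(F(z) − F(0))‖/‖z‖) is pluriharmonic on ℂⁿ \ {0}. -/

import Mathlib

open Filter Topology Complex

section
variable {E : Type*} [NormedAddCommGroup E] [NormedSpace ℂ E]

noncomputable def auxp (θ : ℝ) : ℂ := deriv (circleMap 0 1) θ * (1 / (circleMap 0 1 θ) ^ 2)

lemma auxp_cont : Continuous auxp := by
  unfold auxp
  simp only [deriv_circleMap]
  have h := continuous_circleMap 0 1
  refine (h.mul continuous_const).mul (continuous_const.div (h.pow 2) fun θ => ?_)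
  exact pow_ne_zero _ (by simp)

lemma aux_cauchy [CompleteSpace E] {G : E → E} (hG : Differentiable ℂ G) (x v : E) :
    fderiv ℂ G x v = (2 * Real.pi * I : ℂ)⁻¹ • ∫ θ in (0:ℝ)..2 * Real.pi, auxp θ • G (x + circleMap 0 1 θ • v) := by
  have hl : HasDerivAt (fun s : ℂ => x + s • v) v 0 := by
    simpa using ((hasDerivAt_id (0:ℂ)).smul_const v).const_add x
  have hd : Differentiable ℂ (fun s : ℂ => G (x + s • v)) := by fun_prop
  have h1 := hd.differentiableOn.deriv_eq_smul_circleIntegral (c := 0) (R := 1) one_pos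
  have h2 : HasFDerivAt G (fderiv ℂ G x) (x + (0:ℂ) • v) := by simpa using (hG x).hasFDerivAt
  have h3 : HasDerivAt (fun s : ℂ => G (x + s • v)) (fderiv ℂ G x v) 0 := h2.comp_hasDerivAt 0 hl
  rw [h3.deriv] at h1
  have hne : (2 * Real.pi * I : ℂ) ≠ 0 := by simp [Real.pi_ne_zero]
  rw [← inv_smul_smul₀ hne (fderiv ℂ G x v), ← h1]
  simp only [circleIntegral, sub_zero, auxp, mul_smul]

lemma aux_C1 [FiniteDimensional ℂ E] {G : E → E} (hG : Differentiable ℂ G) : ContDiff ℂ 1 G := by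
  have : CompleteSpace E := FiniteDimensional.complete ℂ E
  rw [← zero_add (1 : WithTop ℕ∞), contDiff_succ_iff_fderiv_apply]
  refine ⟨hG, by simp, fun v => ?_⟩
  rw [contDiff_zero]
  simp_rw [aux_cauchy hG]
  refine Continuous.const_smul ?_ _
  refine intervalIntegral.continuous_parametric_intervalIntegral_of_continuous' ?_ _ _
  have := hG.continuous
  have := auxp_cont
  have := continuous_circleMap 0 1
  unfold Function.uncurry
  fun_prop

lemma aux_C2 [FiniteDimensional ℂ E] {G : E → E} (hG : Differentiable ℂ G) : ContDiff ℂ 2 G := by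
  have : CompleteSpace E := FiniteDimensional.complete ℂ E
  have : ProperSpace E := FiniteDimensional.proper ℂ E
  rw [← one_add_one_eq_two, contDiff_succ_iff_fderiv_apply]
  refine ⟨hG, by simp, fun v => aux_C1 fun x₀ => ?_⟩
  simp_rw [aux_cauchy hG]
  refine DifferentiableAt.const_smul ?_ _
  have hp := auxp_cont
  have hcm := continuous_circleMap 0 1
  have hGc := hG.continuous
  have hfc : Continuous (fderiv ℂ G) := (aux_C1 hG).continuous_fderiv (by simp)
  have hF'c : Continuous (fun q : E × ℝ => auxp q.2 • fderiv ℂ G (q.1 + circleMap 0 1 q.2 • v)) := by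
    fun_prop
  obtain ⟨C, hC⟩ := ((isCompact_closedBall x₀ 1).prod (isCompact_uIcc (a := (0:ℝ)) (b := 2 * Real.pi))).exists_bound_of_continuousOn hF'c.continuousOn
  refine (intervalIntegral.hasFDerivAt_integral_of_dominated_of_fderiv_le (𝕜 := ℂ) (μ := MeasureTheory.volume)
    (F := fun x θ => auxp θ • G (x + circleMap 0 1 θ • v))
    (F' := fun x θ => auxp θ • fderiv ℂ G (x + circleMap 0 1 θ • v))
    (bound := fun _ => C)
    (Metric.closedBall_mem_nhds x₀ one_pos) ?_ ?_ ?_ ?_ ?_ ?_).differentiableAt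
  · refine Eventually.of_forall fun x => Continuous.aestronglyMeasurable ?_
    fun_prop
  · refine Continuous.intervalIntegrable ?_ _ _
    fun_prop
  · refine Continuous.aestronglyMeasurable ?_
    fun_prop
  · refine Eventually.of_forall fun θ hθ x hx => hC (x, θ) ⟨hx, Set.uIoc_subset_uIcc hθ⟩
  · exact intervalIntegrable_const
  · refine Eventually.of_forall fun θ hθ x hx => ?_
    exact ((hasFDerivAt_comp_add_right _).2 (hG _).hasFDerivAt).const_smul _
end


lemma aux_cocompact {k m : ℂ → ℂ} (hk : Differentiable ℂ k) (hm : Differentiable ℂ m)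
    (h1 : ∀ t, m (k t) = t) (h2 : ∀ t, k (m t) = t) (h0 : k 0 = 0) :
    Differentiable ℂ (fun w : ℂ => (k w⁻¹)⁻¹) := by
  have hco : Tendsto k (cocompact ℂ) (cocompact ℂ) :=
    (Homeomorph.mk (Equiv.mk k m h1 h2) hk.continuous hm.continuous).isClosedEmbedding.tendsto_cocompact
  rw [← Metric.cobounded_eq_cocompact] at hco
  have hne : ∀ t, t ≠ 0 → k t ≠ 0 := fun t ht h => ht (by
    have e1 := h1 t
    have e2 := h1 0
    rw [h, ← h0, e2] at e1
    exact e1.symm)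
  rw [← differentiableOn_univ]
  refine (Complex.differentiableOn_compl_singleton_and_continuousAt_iff (c := 0) univ_mem).1 ⟨?_, ?_⟩
  · intro w hw
    have hw0 : w ≠ 0 := by simpa using hw
    exact (((hk _).comp w (differentiableAt_inv hw0)).inv (hne _ (inv_ne_zero hw0))).differentiableWithinAt
  · rw [continuousAt_iff_punctured_nhds]
    simp only [inv_zero, h0]
    exact (tendsto_inv₀_cobounded.comp hco).comp tendsto_inv₀_nhdsNE_zero

lemma aux_line {k m : ℂ → ℂ} (hk : Differentiable ℂ k) (hm : Differentiable ℂ m)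
    (h1 : ∀ t, m (k t) = t) (h2 : ∀ t, k (m t) = t) (h0 : k 0 = 0) (hd : HasDerivAt k 1 0) (t : ℂ) :
    k t = t := by
  have hm0 : m 0 = 0 := by
    have := h1 0
    rwa [h0] at this
  set K : ℂ → ℂ := fun w : ℂ => (k w⁻¹)⁻¹ with hK
  set M : ℂ → ℂ := fun w : ℂ => (m w⁻¹)⁻¹ with hM
  have hKd : Differentiable ℂ K := aux_cocompact hk hm h1 h2 h0
  have hMd : Differentiable ℂ M := aux_cocompact hm hk h2 h1 hm0
  have hK0 : K 0 = 0 := by simp [hK, h0]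
  have hMK : M ∘ K = id := by funext w; simp [hK, hM, h1]
  have hc := (hMd (K 0)).hasDerivAt.comp 0 (hKd 0).hasDerivAt
  rw [hMK] at hc
  have hc1 := hc.unique (hasDerivAt_id 0)
  have hcne : deriv K 0 ≠ 0 := right_ne_zero_of_mul (hc1.trans_ne one_ne_zero)
  have hs := hasDerivAt_iff_tendsto_slope.1 (hKd 0).hasDerivAt
  have hs2 := (hs.inv₀ hcne).comp (tendsto_inv₀_cobounded' : Tendsto (·⁻¹ : ℂ → ℂ) _ _)
  rw [Metric.cobounded_eq_cocompact] at hs2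
  have hD : Differentiable ℂ (dslope k 0) := by
    rw [← differentiableOn_univ]
    exact (Complex.differentiableOn_dslope univ_mem).2 hk.differentiableOn
  have hlim : Tendsto (dslope k 0) (cocompact ℂ) (𝓝 (deriv K 0)⁻¹) := by
    refine hs2.congr' ?_
    have : ∀ᶠ x : ℂ in cocompact ℂ, x ≠ 0 := by
      have := (isCompact_singleton (x := (0:ℂ))).compl_mem_cocompact
      filter_upwards [this] with x hx
      simpa using hx
    filter_upwards [this] with x hx
    rw [dslope_of_ne _ hx]
    simp [slope_def_field, hK, h0]
    field_simp
  have e1 := hD.apply_eq_of_tendsto_cocompact t hlim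
  have e2 := hD.apply_eq_of_tendsto_cocompact 0 hlim
  rw [dslope_same, hd.deriv] at e2
  by_cases ht : t = 0
  · rw [ht, h0]
  rw [← e2, dslope_of_ne _ ht, slope_def_field, h0] at e1
  field_simp at e1
  simpa using e1

section
variable {E : Type*} [NormedAddCommGroup E] [InnerProductSpace ℂ E]

/-- A curve with proportional derivative stays on the line. -/
lemma aux_prop [CompleteSpace E] {g : ℂ → E} (hg : Differentiable ℂ g) (h0 : g 0 = 0) {z : E} (hz : z ≠ 0)
    (hd : HasDerivAt g z 0) (hp : ∀ t, t ≠ 0 → ∃ l : ℂ, deriv g t = l • g t) (t : ℂ) :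
    ∃ l : ℂ, g t = l • z := by
  set h := dslope g 0 with hh
  have hD : Differentiable ℂ h := by
    rw [← differentiableOn_univ]
    exact (Complex.differentiableOn_dslope univ_mem).2 hg.differentiableOn
  have hgh : ∀ t, g t = t • h t := by
    intro t
    have := sub_smul_dslope g 0 t
    rw [h0] at this
    simpa using this.symm
  have hh0 : h 0 = z := by rw [hh, dslope_same, hd.deriv]
  have hder : ∀ t, deriv g t = h t + t • deriv h t := by
    intro t
    have := (hasDerivAt_id t).smul (hD t).hasDerivAt
    have e : g = fun t => (id t) • h t := by funext t; exact hgh t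
    rw [e]
    refine this.deriv.trans ?_
    simp [add_comm]
  have hp' : ∀ t, t ≠ 0 → ∃ l : ℂ, deriv h t = l • h t := by
    intro t ht
    obtain ⟨l, hl⟩ := hp t ht
    rw [hder, hgh t] at hl
    refine ⟨l - t⁻¹, ?_⟩
    have : t • deriv h t = (l * t - 1) • h t := by
      rw [sub_smul, mul_smul, ← hl, one_smul]; abel
    rw [← inv_smul_smul₀ ht (deriv h t), this, smul_smul]
    congr 1
    field_simp
  set a : ℂ → ℂ := fun t => inner ℂ z (h t) with ha
  have haD : ∀ t, HasDerivAt a (inner ℂ z (deriv h t)) t := fun t =>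
    ((innerSL ℂ z).hasFDerivAt.comp_hasDerivAt t (hD t).hasDerivAt)
  have hdc : Continuous (deriv h) := by
    have : ContDiff ℂ 1 h := hD.contDiff
    exact this.continuous_deriv le_rfl
  have hW : ∀ t, a t • deriv h t - (inner ℂ z (deriv h t) : ℂ) • h t = 0 := by
    have hcont : Continuous (fun t => a t • deriv h t - (inner ℂ z (deriv h t) : ℂ) • h t) := by
      have := hD.continuous
      fun_prop
    have hcl := isClosed_singleton.preimage (t := {(0:E)}) hcont
    have hde : Dense ({(0:ℂ)}ᶜ) := dense_compl_singleton 0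
    have := hcl.closure_subset_iff (s := {(0:ℂ)}ᶜ) |>.2 (by
      intro t ht
      obtain ⟨l, hl⟩ := hp' t (by simpa using ht)
      simp only [Set.mem_preimage, Set.mem_singleton_iff, hl, ha, inner_smul_right, smul_smul]
      rw [mul_comm, sub_self])
    intro t
    exact this (hde.closure_eq ▸ Set.mem_univ t)
  have ha0 : a 0 ≠ 0 := by simp [ha, hh0, hz]
  have hac : Continuous a := continuous_iff_continuousAt.2 fun t => (haD t).continuousAt
  obtain ⟨r, hr, hball⟩ := Metric.eventually_nhds_iff_ball.1 (hac.continuousAt.eventually_ne ha0)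
  have hconst : ∀ t ∈ Metric.ball (0:ℂ) r, (a t)⁻¹ • h t = (a 0)⁻¹ • h 0 := by
    intro t ht
    have hder2 : ∀ s ∈ Metric.ball (0:ℂ) r, HasDerivAt (fun t => (a t)⁻¹ • h t) 0 s := by
      intro s hs
      have hs' := hball s hs
      have := ((haD s).inv hs').smul (hD s).hasDerivAt
      refine this.congr_deriv ?_
      have hw := sub_eq_zero.1 (hW s)
      have : deriv h s = ((a s)⁻¹ * (inner ℂ z (deriv h s) : ℂ)) • h s := by
        rw [mul_smul, ← hw, inv_smul_smul₀ hs']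
      rw [neg_div, neg_smul, div_eq_mul_inv]
      nth_rewrite 1 [this]
      simp only [Pi.inv_apply]
      rw [smul_smul, ← sub_eq_add_neg, ← sub_smul]
      rw [mul_comm, pow_two]
      have h3 : (a s)⁻¹ * (inner ℂ z (deriv h s) : ℂ) * (a s)⁻¹ - (inner ℂ z (deriv h s) : ℂ) * (a s * a s)⁻¹ = 0 := by
        field_simp
        ring
      rw [h3, zero_smul]
    refine IsOpen.is_const_of_deriv_eq_zero (𝕜 := ℂ) (f := fun t => (a t)⁻¹ • h t) Metric.isOpen_ball (convex_ball 0 r).isPreconnected ?_ ?_ ht (Metric.mem_ball_self hr)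
    · exact fun s hs => (hder2 s hs).differentiableAt.differentiableWithinAt
    · exact fun s hs => (hder2 s hs).deriv
  have hEq : h = fun t => a t • ((a 0)⁻¹ • z) := by
    have hA1 : AnalyticOnNhd ℂ h Set.univ := fun x _ => hD.analyticAt x
    have hA2 : AnalyticOnNhd ℂ (fun t => a t • ((a 0)⁻¹ • z)) Set.univ := fun x _ =>
      Differentiable.analyticAt (fun t => (haD t).differentiableAt.smul_const _) x
    refine hA1.eq_of_eventuallyEq hA2 (z₀ := 0) ?_
    filter_upwards [Metric.ball_mem_nhds (0:ℂ) hr] with t ht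
    have := hconst t ht
    rw [← hh0, ← this, smul_inv_smul₀ (hball t ht)]
  refine ⟨t * (a t * (a 0)⁻¹), ?_⟩
  rw [hgh t, mul_smul, mul_smul]
  congr 1
  exact congrFun hEq t

/-- second derivative of log norm along a curve -/
lemma aux_log {a b : ℝ → E} {c : E} (ha : ∀ᶠ s in 𝓝 0, HasDerivAt a (b s) s) (hb : HasDerivAt b c 0)
    (h0 : a 0 ≠ 0) :
    HasDerivAt (deriv fun s => Real.log ‖a s‖)
      ((‖b 0‖^2 + (inner ℂ (a 0) c : ℂ).re) / ‖a 0‖^2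
        - 2 * ((inner ℂ (a 0) (b 0) : ℂ).re)^2 / (‖a 0‖^2)^2) 0 := by
  have hc : ContinuousAt a 0 := ha.self_of_nhds.continuousAt
  have hre : ∀ {f g : ℝ → E} {f' g' : E} {s : ℝ}, HasDerivAt f f' s → HasDerivAt g g' s →
      HasDerivAt (fun s => (inner ℂ (f s) (g s) : ℂ).re)
        ((inner ℂ (f s) g' : ℂ).re + (inner ℂ f' (g s) : ℂ).re) s := by
    intro f g f' g' s hf hg
    have := Complex.reCLM.hasFDerivAt.comp_hasDerivAt s (hf.inner ℂ hg)
    rw [map_add] at this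
    exact this
  have hsq : ∀ x : E, ‖x‖^2 = (inner ℂ x x : ℂ).re := fun x => by
    rw [inner_self_eq_norm_sq_to_K]; norm_cast
  have hlog : ∀ x : E, Real.log ‖x‖ = (1/2) * Real.log ((inner ℂ x x : ℂ).re) := fun x => by
    rw [← hsq, Real.log_pow]; push_cast; ring
  have hev : (deriv fun s => Real.log ‖a s‖) =ᶠ[𝓝 0]
      fun s => (inner ℂ (a s) (b s) : ℂ).re / (inner ℂ (a s) (a s) : ℂ).re := by
    filter_upwards [ha, hc.eventually_ne h0] with s hs hne
    have hq : (inner ℂ (a s) (a s) : ℂ).re ≠ 0 := by rw [← hsq]; simpa using hne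
    simp_rw [hlog]
    have := ((hre hs hs).log hq).const_mul (1/2)
    rw [this.deriv]
    have e : (inner ℂ (b s) (a s) : ℂ).re = (inner ℂ (a s) (b s) : ℂ).re := by
      rw [← inner_conj_symm, Complex.conj_re]
    rw [e]; ring
  have hq : (inner ℂ (a 0) (a 0) : ℂ).re ≠ 0 := by rw [← hsq]; simpa using h0
  have hs := ha.self_of_nhds
  have := (hre hs hb).div (hre hs hs) hq
  refine (this.congr_of_eventuallyEq hev).congr_deriv ?_
  have e : (inner ℂ (b 0) (a 0) : ℂ).re = (inner ℂ (a 0) (b 0) : ℂ).re := by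
    rw [← inner_conj_symm, Complex.conj_re]
  rw [e, hsq, hsq]
  field_simp
  ring

/-- second derivative along a line -/
lemma aux_second {V : Type*} [NormedAddCommGroup V] [NormedSpace ℝ V] {u : V → ℝ} {x : V}
    (hu : ContDiffAt ℝ 2 u x) (v : V) :
    iteratedFDeriv ℝ 2 u x ![v, v] = deriv (deriv fun s : ℝ => u (x + s • v)) 0 := by
  have hl : ∀ s : ℝ, HasDerivAt (fun s : ℝ => x + s • v) v s := fun s => by
    simpa using ((hasDerivAt_id s).smul_const v).const_add x
  have hev : (deriv fun s : ℝ => u (x + s • v)) =ᶠ[𝓝 0] fun s => fderiv ℝ u (x + s • v) v := by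
    have h1 : ∀ᶠ y in 𝓝 x, DifferentiableAt ℝ u y := by
      filter_upwards [hu.eventually (by simp)] with y hy
      exact hy.differentiableAt (by simp)
    have h2 : Tendsto (fun s : ℝ => x + s • v) (𝓝 0) (𝓝 x) := by
      have := (hl 0).continuousAt.tendsto
      simpa using this
    filter_upwards [h2.eventually h1] with s hs
    exact (hs.hasFDerivAt.comp_hasDerivAt s (hl s)).deriv
  rw [hev.deriv_eq, iteratedFDeriv_two_apply]
  have hd : DifferentiableAt ℝ (fderiv ℝ u) x :=
    (hu.fderiv_right (m := 1) (by norm_num)).differentiableAt (by simp)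
  have h3 : HasFDerivAt (fderiv ℝ u) (fderiv ℝ (fderiv ℝ u) x) (x + (0:ℝ) • v) := by
    simpa using hd.hasFDerivAt
  have h4 := h3.comp_hasDerivAt (0:ℝ) (hl 0)
  have h5 := (ContinuousLinearMap.apply ℝ ℝ v).hasFDerivAt.comp_hasDerivAt (0:ℝ) h4
  exact h5.deriv.symm

lemma aux_dir {G : E → E} (hG : ContDiff ℂ 2 G) {x : E} (hx : G x ≠ 0) (v : E) :
    HasDerivAt (deriv fun s : ℝ => Real.log ‖G (x + s • v)‖)
      ((‖fderiv ℂ G x v‖^2 + (inner ℂ (G x) (fderiv ℂ (fderiv ℂ G) x v v) : ℂ).re) / ‖G x‖^2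
        - 2 * ((inner ℂ (G x) (fderiv ℂ G x v) : ℂ).re)^2 / (‖G x‖^2)^2) 0 := by
  have hl : ∀ s : ℝ, HasDerivAt (fun s : ℝ => x + s • v) v s := fun s => by
    simpa using ((hasDerivAt_id s).smul_const v).const_add x
  have hd1 : Differentiable ℂ G := hG.differentiable (by simp)
  have hd2 : Differentiable ℂ (fderiv ℂ G) :=
    (hG.fderiv_right (m := 1) (by norm_num)).differentiable (by simp)
  have h2 : HasFDerivAt (fun y => fderiv ℂ G y v) ((ContinuousLinearMap.apply ℂ E v).comp (fderiv ℂ (fderiv ℂ G) x))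
      (x + (0:ℝ) • v) := by
    rw [zero_smul, add_zero]
    exact (ContinuousLinearMap.apply ℂ E v).hasFDerivAt.comp x (hd2 x).hasFDerivAt
  have h4 : HasDerivAt (fun s : ℝ => fderiv ℂ G (x + s • v) v) (fderiv ℂ (fderiv ℂ G) x v v) 0 := by
    have h5 := h2.restrictScalars ℝ
    exact h5.comp_hasDerivAt (0:ℝ) (hl 0)
  have h3 := aux_log (a := fun s : ℝ => G (x + s • v)) (b := fun s : ℝ => fderiv ℂ G (x + s • v) v)
    (c := fderiv ℂ (fderiv ℂ G) x v v)
    (Eventually.of_forall fun s =>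
      ((hd1 _).hasFDerivAt.restrictScalars ℝ).comp_hasDerivAt s (hl s))
    h4
    (by simpa using hx)
  simpa only [zero_smul, add_zero] using h3

/-- sum over `v` and `I v` -/
lemma aux_sum {G : E → E} (hG : ContDiff ℂ 2 G) {x : E} (hx : G x ≠ 0) (v : E) :
    deriv (deriv fun s : ℝ => Real.log ‖G (x + s • v)‖) 0
      + deriv (deriv fun s : ℝ => Real.log ‖G (x + s • (I • v))‖) 0 =
    2 * (‖fderiv ℂ G x v‖^2 * ‖G x‖^2 - ‖(inner ℂ (G x) (fderiv ℂ G x v) : ℂ)‖^2) / (‖G x‖^2)^2 := by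
  rw [(aux_dir hG hx v).deriv, (aux_dir hG hx (I • v)).deriv]
  have hn : ‖G x‖ ≠ 0 := norm_ne_zero_iff.2 hx
  simp only [map_smul, _root_.smul_apply, smul_smul, inner_smul_right, norm_smul, I_mul_I,
    neg_smul, one_smul, inner_neg_right, norm_I, one_mul, neg_re, I_mul_re]
  rw [← Complex.normSq_eq_norm_sq (inner ℂ (G x) (fderiv ℂ G x v)), Complex.normSq_apply]
  field_simp
  ring

lemma aux_contDiffAt {G : E → E} (hG : ContDiff ℂ 2 G) {x : E} (hx : G x ≠ 0) :
    ContDiffAt ℝ 2 (fun y => Real.log ‖G y‖) x := by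
  have h1 : ContDiffAt ℝ 2 G x := (hG.restrict_scalars ℝ).contDiffAt
  have h2 : ContDiffAt ℝ 2 (fun y => ‖G y‖) x := h1.norm ℂ hx
  exact h2.log (norm_ne_zero_iff.2 hx)

lemma aux_key {G : E → E} (hC : ContDiff ℂ 2 G) {x : E} (hx0 : x ≠ 0) (hx : G x ≠ 0)
    (h : iteratedFDeriv ℝ 2 (fun x => Real.log (‖G x‖ / ‖x‖)) x ![x, x]
      + iteratedFDeriv ℝ 2 (fun x => Real.log (‖G x‖ / ‖x‖)) x ![I • x, I • x] = 0) :
    ∃ l : ℂ, fderiv ℂ G x x = l • G x := by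
  have hid : ContDiff ℂ 2 (fun y : E => y) := contDiff_id
  have hu1 := aux_contDiffAt hC hx
  have hu2 := aux_contDiffAt hid hx0
  have hev : (fun y => Real.log (‖G y‖ / ‖y‖)) =ᶠ[𝓝 x]
      ((fun y => Real.log ‖G y‖) + fun y => - Real.log ‖y‖) := by
    filter_upwards [hC.continuous.continuousAt.eventually_ne hx, (continuousAt_id (x := x)).eventually_ne hx0]
      with y h1 h2
    change y ≠ 0 at h2
    rw [Real.log_div (norm_ne_zero_iff.2 h1) (norm_ne_zero_iff.2 h2), sub_eq_add_neg]
    rfl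
  have hsplit : ∀ v : E, iteratedFDeriv ℝ 2 (fun x => Real.log (‖G x‖ / ‖x‖)) x ![v, v] =
      deriv (deriv fun s : ℝ => Real.log ‖G (x + s • v)‖) 0
      - deriv (deriv fun s : ℝ => Real.log ‖x + s • v‖) 0 := by
    intro v
    rw [(hev.iteratedFDeriv ℝ 2).eq_of_nhds, iteratedFDeriv_add_apply hu1 hu2.neg,
      ← aux_second hu1 v, ← aux_second hu2 v]
    have : iteratedFDeriv ℝ 2 (fun y : E => - Real.log ‖y‖) x
        = - iteratedFDeriv ℝ 2 (fun y : E => Real.log ‖y‖) x := iteratedFDeriv_neg_apply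
    rw [this]
    simp [sub_eq_add_neg]
  rw [hsplit, hsplit] at h
  have e1 := aux_sum hC hx x
  have e2 := aux_sum hid hx0 x
  have e3 : ‖(inner ℂ x x : ℂ)‖ = ‖x‖ * ‖x‖ := by
    rw [inner_self_eq_norm_sq_to_K]; simp [pow_two]
  rw [fderiv_fun_id, ContinuousLinearMap.id_apply, e3] at e2
  have e4 : 2 * (‖fderiv ℂ G x x‖^2 * ‖G x‖^2 - ‖(inner ℂ (G x) (fderiv ℂ G x x) : ℂ)‖^2) / (‖G x‖^2)^2 = 0 := by
    have e5 : 2 * (‖x‖ ^ 2 * ‖x‖ ^ 2 - (‖x‖ * ‖x‖) ^ 2) / (‖x‖ ^ 2) ^ 2 = 0 := by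
      ring
    rw [e5] at e2
    linarith
  have hn : ‖G x‖ ≠ 0 := norm_ne_zero_iff.2 hx
  have e6 : (‖(inner ℂ (G x) (fderiv ℂ G x x) : ℂ)‖)^2 = (‖G x‖ * ‖fderiv ℂ G x x‖)^2 := by
    field_simp at e4
    linarith
  have e7 := (sq_eq_sq₀ (norm_nonneg _) (by positivity)).1 e6
  by_cases hz : fderiv ℂ G x x = 0
  · exact ⟨0, by simp [hz]⟩
  · obtain ⟨r, -, hr⟩ := (norm_inner_eq_norm_iff hx hz).1 e7
    exact ⟨r, hr⟩
end

section
variable {E : Type*} [NormedAddCommGroup E] [InnerProductSpace ℂ E] [FiniteDimensional ℂ E]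

lemma aux_main {G H : E → E} (hG : Differentiable ℂ G) (hH : Differentiable ℂ H)
    (hHG : ∀ x, H (G x) = x) (hGH : ∀ x, G (H x) = x) (h0 : G 0 = 0)
    (hd : fderiv ℂ G 0 = ContinuousLinearMap.id ℂ E)
    (h : ∀ x : E, x ≠ 0 → iteratedFDeriv ℝ 2 (fun x => Real.log (‖G x‖ / ‖x‖)) x ![x, x]
      + iteratedFDeriv ℝ 2 (fun x => Real.log (‖G x‖ / ‖x‖)) x ![I • x, I • x] = 0) (z : E) :
    G z = z := by
  have : CompleteSpace E := FiniteDimensional.complete ℂ E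
  by_cases hz : z = 0
  · rw [hz, h0]
  have hne : ∀ x, x ≠ 0 → G x ≠ 0 := by
    intro x hx hGx
    have e1 := hHG x
    have e2 := hHG 0
    rw [hGx, ← h0, e2] at e1
    exact hx e1.symm
  have hl : ∀ (x : E) (t : ℂ), HasDerivAt (fun t : ℂ => t • x) x t := fun x t => by
    simpa using (hasDerivAt_id t).smul_const x
  have hderG : ∀ (x : E) (t : ℂ), HasDerivAt (fun t : ℂ => G (t • x)) (fderiv ℂ G (t • x) x) t :=
    fun x t => (hG _).hasFDerivAt.comp_hasDerivAt t (hl x t)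
  have hder0 : ∀ x : E, HasDerivAt (fun t : ℂ => G (t • x)) x 0 := fun x => by
    simpa [hd] using hderG x 0
  have hlineG : ∀ (x : E) (t : ℂ), ∃ l : ℂ, G (t • x) = l • x := by
    intro x t
    by_cases hx : x = 0
    · exact ⟨0, by simp [hx, h0]⟩
    refine aux_prop (g := fun t : ℂ => G (t • x)) (fun t => (hderG x t).differentiableAt)
      (by simp [h0]) hx (hder0 x) ?_ t
    intro s hs
    have hsx : s • x ≠ 0 := smul_ne_zero hs hx
    obtain ⟨l, hl'⟩ := aux_key (aux_C2 hG) hsx (hne _ hsx) (h _ hsx)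
    refine ⟨s⁻¹ * l, ?_⟩
    rw [(hderG x s).deriv, mul_smul, ← hl', map_smul, inv_smul_smul₀ hs]
  have hlineH : ∀ (x : E) (t : ℂ), ∃ l : ℂ, H (t • x) = l • x := by
    intro x t
    obtain ⟨l, hl'⟩ := hlineG (H (t • x)) 1
    rw [one_smul, hGH] at hl'
    by_cases hl0 : l = 0
    · refine ⟨0, ?_⟩
      rw [hl', hl0, zero_smul, zero_smul]
      have := hHG 0
      rwa [h0] at this
    · refine ⟨l⁻¹ * t, ?_⟩
      rw [mul_smul, hl', inv_smul_smul₀ hl0, ← hl']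
  choose k hk using hlineG z
  choose m hm using hlineH z
  have hzz : (inner ℂ z z : ℂ) ≠ 0 := by simpa using hz
  have hcoord : ∀ {f : E} {c : ℂ}, f = c • z → c = (inner ℂ z z : ℂ)⁻¹ * innerSL ℂ z f := by
    intro f c hf
    rw [hf, innerSL_apply_apply, inner_smul_right]
    field_simp
  have hk' : k = fun t => (inner ℂ z z : ℂ)⁻¹ * innerSL ℂ z (G (t • z)) := by
    funext t; exact hcoord (hk t)
  have hm' : m = fun t => (inner ℂ z z : ℂ)⁻¹ * innerSL ℂ z (H (t • z)) := by
    funext t; exact hcoord (hm t)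
  have hkd : Differentiable ℂ k := by
    rw [hk']
    fun_prop
  have hmd : Differentiable ℂ m := by
    rw [hm']
    fun_prop
  have hinj : ∀ {a b : ℂ}, a • z = b • z → a = b := fun {a b} hab => smul_left_injective ℂ hz hab
  have hmk : ∀ t, m (k t) = t := fun t => hinj (by rw [← hm, ← hk, hHG])
  have hkm : ∀ t, k (m t) = t := fun t => hinj (by rw [← hk, ← hm, hGH])
  have hk0 : k 0 = 0 := hinj (by rw [← hk]; simp [h0])
  have hkder : HasDerivAt k 1 0 := by
    have h1 := ((innerSL ℂ z).hasFDerivAt.comp_hasDerivAt (0:ℂ) (hder0 z)).const_mul (inner ℂ z z : ℂ)⁻¹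
    rw [hk']
    refine h1.congr_deriv ?_
    rw [innerSL_apply_apply, inv_mul_cancel₀ hzz]
  have := aux_line hkd hmd hmk hkm hk0 hkder 1
  have h2 := hk 1
  rwa [this, one_smul] at h2
end

noncomputable def levi {n : ℕ} (g : EuclideanSpace ℂ (Fin n) → ℝ)
    (z v w : EuclideanSpace ℂ (Fin n)) : ℂ :=
  (1/4 : ℂ) * ((((iteratedFDeriv ℝ 2 g z ![v, w]
      + iteratedFDeriv ℝ 2 g z ![Complex.I • v, Complex.I • w] : ℝ)) : ℂ)
    + Complex.I * (((iteratedFDeriv ℝ 2 g z ![Complex.I • v, w]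
      - iteratedFDeriv ℝ 2 g z ![v, Complex.I • w] : ℝ)) : ℂ))

theorem affine_iff_log_ratio_pluriharmonic {n : ℕ}
    (F : EuclideanSpace ℂ (Fin n) → EuclideanSpace ℂ (Fin n))
    (hF : Differentiable ℂ F)
    (Finv : EuclideanSpace ℂ (Fin n) → EuclideanSpace ℂ (Fin n))
    (hFinv : Differentiable ℂ Finv)
    (hFl : Function.LeftInverse Finv F) (hFr : Function.RightInverse Finv F) :
    (∀ z, F z = F 0 + fderiv ℂ F 0 z) ↔
      (∀ z : EuclideanSpace ℂ (Fin n), z ≠ 0 → ∀ v w,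
        levi (fun x => Real.log
          (‖(fderiv ℂ F 0).inverse (F x - F 0)‖ / ‖x‖)) z v w = 0) := by 
  have hcomp1 : (fderiv ℂ Finv (F 0)).comp (fderiv ℂ F 0) = ContinuousLinearMap.id ℂ _ := by
    have h1 := (hFinv (F 0)).hasFDerivAt.comp 0 (hF 0).hasFDerivAt
    rw [show Finv ∘ F = id from funext hFl] at h1
    exact h1.unique (hasFDerivAt_id 0)
  have hcomp2 : (fderiv ℂ F 0).comp (fderiv ℂ Finv (F 0)) = ContinuousLinearMap.id ℂ _ := by
    have h0 : HasFDerivAt F (fderiv ℂ F 0) (Finv (F 0)) := by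
      rw [hFl 0]; exact (hF 0).hasFDerivAt
    have h1 := h0.comp (F 0) (hFinv (F 0)).hasFDerivAt
    rw [show F ∘ Finv = id from funext hFr] at h1
    exact h1.unique (hasFDerivAt_id _)
  have hinv : (fderiv ℂ F 0).inverse = fderiv ℂ Finv (F 0) :=
    ContinuousLinearMap.inverse_eq hcomp2 hcomp1
  have happ1 : ∀ x, fderiv ℂ Finv (F 0) (fderiv ℂ F 0 x) = x := fun x => by
    simpa using congrArg (fun L => L x) hcomp1
  have happ2 : ∀ x, fderiv ℂ F 0 (fderiv ℂ Finv (F 0) x) = x := fun x => by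
    simpa using congrArg (fun L => L x) hcomp2
  rw [hinv]
  constructor
  · intro hA z hz v w
    have hfun : (fun x => Real.log (‖fderiv ℂ Finv (F 0) (F x - F 0)‖ / ‖x‖)) = fun _ => (0:ℝ) := by
      funext x
      have : F x - F 0 = fderiv ℂ F 0 x := by rw [hA x]; simp
      rw [this, happ1]
      by_cases hx : x = 0
      · simp [hx]
      · rw [div_self (norm_ne_zero_iff.2 hx), Real.log_one]
    rw [hfun]
    have h0 : iteratedFDeriv ℝ 2 (fun _ : EuclideanSpace ℂ (Fin n) => (0:ℝ)) z = 0 := by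
      rw [iteratedFDeriv_const_of_ne two_ne_zero]
      rfl
    unfold levi
    rw [h0]
    simp
  · intro hL z
    have key := aux_main (G := fun x => fderiv ℂ Finv (F 0) (F x - F 0))
      (H := fun y => Finv (fderiv ℂ F 0 y + F 0)) (by fun_prop) (by fun_prop)
      (fun x => by simp only [happ2, sub_add_cancel]; exact hFl x)
      (fun x => by simp only [hFr _, add_sub_cancel_right, happ1])
      (by simp) (by
        have h1 := (fderiv ℂ Finv (F 0)).hasFDerivAt.comp (0 : EuclideanSpace ℂ (Fin n)) ((hF 0).hasFDerivAt.sub_const (F 0))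
        rw [hcomp1] at h1
        exact h1.fderiv)
      (fun x hx => by
        have h1 := congrArg Complex.re (hL x hx x x)
        unfold levi at h1
        have h2 : ∀ a b : ℝ, ((1/4 : ℂ) * ((a : ℂ) + Complex.I * (b : ℂ))).re = a / 4 := by
          intro a b
          have : (1/4 : ℂ) = ((1/4 : ℝ) : ℂ) := by norm_num
          rw [this, Complex.re_ofReal_mul]
          simp
          ring
        rw [h2] at h1
        simp only [Complex.zero_re] at h1
        have h3 := (div_eq_zero_iff.1 h1).resolve_right (by norm_num)
        exact h3) z
    have h5 := congrArg (fderiv ℂ F 0) key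
    simp only [happ2] at h5
    rw [← h5]
    simp
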